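/- arXiv:1809.09760 — 4 statements merged into one kernel-verified Lean document; each statement's English description precedes it below -/
import Mathlib

section
/- Let k be an algebraically closed field and B a finite-dimensional basic k-algebra, i.e. B/J(B) is isomorphic as a k-algebra to a finite product of copies of k. Then every maximal subalgebra A ⊆ B has dimension dim_k A = dim_k B − 1. -/
/-- A finite-dimensional `k`-algebra `B` is *basic* if `B/J(B)` is isomorphic, as a
`k`-algebra, to a finite product of copies of `k`; equivalently, there is a surjective
`k`-algebra homomorphism `B → k^n` whose kernel is the Jacobson radical `J(B)`. -/
def IsBasicAlgebra (k : Type) [Field k] (B : Type) [Ring B] [Algebra k B] : Prop :=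
  ∃ (n : ℕ) (f : B →ₐ[k] (Fin n → k)), Function.Surjective f ∧
    RingHom.ker (f : B →+* (Fin n → k)) = Ideal.jacobson (⊥ : Ideal B)

/-- A maximal subalgebra `A` absorbs everything up to a single line `k • x` as soon as the
line is stable modulo `A` under multiplication by `A` and `x * x ∈ A`. -/
theorem Subalgebra.exists_sub_smul_mem_of_maximal {k B : Type*} [Field k] [Ring B] [Algebra k B]
    {A : Subalgebra k B} (hmax : ∀ C : Subalgebra k B, A < C → C = ⊤) {x : B} (hx : x ∉ A)
    (hleft : ∀ a ∈ A, ∃ t : k, a * x - t • x ∈ A)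
    (hright : ∀ a ∈ A, ∃ t : k, x * a - t • x ∈ A) (hsq : x * x ∈ A) (b : B) :
    ∃ t : k, b - t • x ∈ A := by
  let C : Subalgebra k B :=
    { carrier := {b | ∃ t : k, b - t • x ∈ A}
      mul_mem' := by
        rintro b c ⟨s, hs⟩ ⟨t, ht⟩
        obtain ⟨u, hu⟩ := hleft _ hs
        obtain ⟨v, hv⟩ := hright _ ht
        refine ⟨t * u + s * v, ?_⟩
        have key : b * c - (t * u + s * v) • x =
            (b - s • x) * (c - t • x) + t • ((b - s • x) * x - u • x)
              + s • (x * (c - t • x) - v • x) + (s * t) • (x * x) := by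
          simp only [sub_mul, mul_sub, smul_sub, smul_mul_assoc, mul_smul_comm, add_smul, mul_smul]
          rw [smul_comm t s (x * x)]
          abel
        rw [key]
        exact A.add_mem (A.add_mem (A.add_mem (A.mul_mem hs ht) (A.smul_mem hu t))
          (A.smul_mem hv s)) (A.smul_mem hsq _)
      add_mem' := by
        rintro b c ⟨s, hs⟩ ⟨t, ht⟩
        refine ⟨s + t, ?_⟩
        rw [add_smul, add_sub_add_comm]
        exact A.add_mem hs ht
      algebraMap_mem' := fun r => ⟨0, by simp⟩ }
  have hAC : A < C := by
    refine lt_of_le_of_ne (fun a ha => ⟨0, by simpa using ha⟩) fun h => hx ?_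
    rw [h]
    exact ⟨1, by simp⟩
  have : b ∈ C := hmax C hAC ▸ Algebra.mem_top
  exact this

/-- A proper subalgebra that together with a line spans the whole algebra has codimension one. -/
theorem Subalgebra.finrank_eq_sub_one_of_exists_sub_smul_mem {k B : Type*} [Field k] [Ring B]
    [Algebra k B] [FiniteDimensional k B] {A : Subalgebra k B} (hA : A ≠ ⊤) (x : B)
    (h : ∀ b, ∃ t : k, b - t • x ∈ A) : Module.finrank k A = Module.finrank k B - 1 := by
  have hlt : Module.finrank k A < Module.finrank k B :=
    Submodule.finrank_lt fun h => hA (Algebra.toSubmodule_eq_top.mp h)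
  have htop : Subalgebra.toSubmodule A ⊔ Submodule.span k {x} = ⊤ := by
    refine eq_top_iff.mpr fun b _ => ?_
    obtain ⟨t, ht⟩ := h b
    exact Submodule.mem_sup.mpr ⟨b - t • x, ht, t • x,
      Submodule.smul_mem _ _ (Submodule.mem_span_singleton_self x), sub_add_cancel _ _⟩
  have hle := Submodule.finrank_add_le_finrank_add_finrank
    (Subalgebra.toSubmodule A) (Submodule.span k {x})
  have hspan : Module.finrank k (Submodule.span k {x}) ≤ 1 := by
    simpa using finrank_span_le_card (R := k) ({x} : Set B)
  rw [htop, finrank_top] at hle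
  have : Module.finrank k (Subalgebra.toSubmodule A) = Module.finrank k A := rfl
  omega

/-- A subalgebra containing the kernel of a homomorphism `f` to `k ^ n` is everything as soon as
the coordinates of `f` are pairwise distinct on it. -/
theorem Subalgebra.eq_top_of_ker_le_of_separates {k B ι : Type*} [Field k] [Ring B] [Algebra k B]
    [Finite ι] {f : B →ₐ[k] (ι → k)} {A : Subalgebra k B} (hker : ∀ b, f b = 0 → b ∈ A)
    (hsep : ∀ i j, (∀ a ∈ A, f a i = f a j) → i = j) : A = ⊤ := by
  cases nonempty_fintype ι
  classical
  let χ : ι → (A →* k) := fun i =>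
    (((Pi.evalAlgHom k (fun _ : ι => k) i).comp (f.comp A.val) : A →ₐ[k] k) : A →* k)
  have hχ : Function.Injective χ := fun i j hij =>
    hsep i j fun a ha => DFunLike.congr_fun hij (⟨a, ha⟩ : A)
  have hli := (linearIndependent_monoidHom A k).comp χ hχ
  have hrange : LinearMap.range (f.comp A.val).toLinearMap = ⊤ := by
    by_contra hne
    obtain ⟨g, hg, hgr⟩ := Submodule.exists_le_ker_of_lt_top _ (lt_top_iff_ne_top.mpr hne)
    refine hg (LinearMap.pi_ext' fun i => LinearMap.ext_ring ?_)
    have hzero : ∑ i, g (Pi.single i 1) • (χ i : A → k) = 0 := by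
      funext a
      have ha : g (f a) = 0 := hgr ⟨a, rfl⟩
      rw [LinearMap.pi_apply_eq_sum_univ] at ha
      have hsingle : ∀ i : ι, (Pi.single i 1 : ι → k) = fun j => if i = j then 1 else 0 :=
        fun i => funext fun j => by simp [Pi.single_apply, eq_comm]
      simpa [χ, mul_comm, hsingle] using ha
    simpa using Fintype.linearIndependent_iff.mp hli _ hzero i
  refine eq_top_iff.mpr fun b _ => ?_
  obtain ⟨a, ha⟩ : f b ∈ LinearMap.range (f.comp A.val).toLinearMap := hrange ▸ trivial
  have hba : b - a ∈ A := hker _ (by rw [map_sub, sub_eq_zero]; exact ha.symm)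
  simpa using A.add_mem hba a.2

/-- A maximal subalgebra containing the kernel of a surjection onto `k ^ n` has a complementary
line. -/
theorem Subalgebra.exists_line_of_maximal_of_ker_le {k B ι : Type*} [Field k] [Ring B]
    [Algebra k B] [Finite ι] {f : B →ₐ[k] (ι → k)} (hf : Function.Surjective f)
    {A : Subalgebra k B} (hproper : A ≠ ⊤) (hmax : ∀ C : Subalgebra k B, A < C → C = ⊤)
    (hker : ∀ b, f b = 0 → b ∈ A) : ∃ x : B, ∀ b, ∃ t : k, b - t • x ∈ A := by
  classical
  have hnsep : ¬ ∀ i j, (∀ a ∈ A, f a i = f a j) → i = j :=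
    fun h => hproper (Subalgebra.eq_top_of_ker_le_of_separates hker h)
  push Not at hnsep
  obtain ⟨i, j, hij, hne⟩ := hnsep
  obtain ⟨x, hx⟩ := hf (Pi.single i 1)
  let C : Subalgebra k B := AlgHom.equalizer ((Pi.evalAlgHom k (fun _ : ι => k) i).comp f)
    ((Pi.evalAlgHom k (fun _ : ι => k) j).comp f)
  have hC : ∀ b, b ∈ C ↔ f b i = f b j := fun b => Iff.rfl
  have hAC : A = C := by
    by_contra h
    have hxC : x ∈ C := hmax C (lt_of_le_of_ne (fun a ha => hij a ha) h) ▸ Algebra.mem_top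
    rw [hC, hx] at hxC
    simp [hne.symm] at hxC
  refine ⟨x, fun b => ⟨f b i - f b j, ?_⟩⟩
  rw [hAC, hC]
  simp [hx, hne.symm]

/-- If a maximal subalgebra contains the power `I ^ (m + 2)` of the kernel `I` of a surjection onto
`k ^ n`, but not `I ^ (m + 1)`, then it has a complementary line. -/
theorem Subalgebra.exists_line_of_maximal_of_pow_ker_le {k B ι : Type*} [Field k] [Ring B]
    [Algebra k B] [Finite ι] {f : B →ₐ[k] (ι → k)} (hf : Function.Surjective f)
    {A : Subalgebra k B} (hmax : ∀ C : Subalgebra k B, A < C → C = ⊤) {m : ℕ}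
    (hle : ∀ b ∈ RingHom.ker f ^ (m + 2), b ∈ A)
    (hnle : ¬ ∀ b ∈ RingHom.ker f ^ (m + 1), b ∈ A) :
    ∃ x : B, ∀ b, ∃ t : k, b - t • x ∈ A := by
  cases nonempty_fintype ι
  classical
  push Not at hnle
  obtain ⟨x, hxI, hxA⟩ := hnle
  set I : Ideal B := RingHom.ker f with hI
  choose c hc using fun i => hf (Pi.single i (1 : k))
  have hsum : 1 - ∑ i, c i ∈ I := by
    rw [hI, RingHom.mem_ker, map_sub, map_one, map_sum, sub_eq_zero]
    simp only [hc]
    exact (Finset.univ_sum_single (1 : ι → k)).symm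
  have hmulL : ∀ {a b}, a ∈ I → b ∈ I ^ (m + 1) → a * b ∈ A := fun ha hb =>
    hle _ (by rw [Ideal.IsTwoSided.pow_succ]; exact Ideal.mul_mem_mul ha hb)
  have hmulR : ∀ {a b}, a ∈ I ^ (m + 1) → b ∈ I → a * b ∈ A := fun ha hb =>
    hle _ (by rw [Submodule.pow_succ]; exact Ideal.mul_mem_mul ha hb)
  obtain ⟨i, hi⟩ : ∃ i, c i * x ∉ A := by
    by_contra! h
    refine hxA ?_
    have hx : x = (1 - ∑ i, c i) * x + ∑ i, c i * x := by
      rw [← Finset.sum_mul, ← add_mul, sub_add_cancel, one_mul]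
    rw [hx]
    exact A.add_mem (hmulL hsum hxI) (A.sum_mem fun i _ => h i)
  have hixI : c i * x ∈ I ^ (m + 1) := Ideal.mul_mem_left _ _ hxI
  obtain ⟨j, hj⟩ : ∃ j, c i * x * c j ∉ A := by
    by_contra! h
    refine hi ?_
    have hx : c i * x = c i * x * (1 - ∑ j, c j) + ∑ j, c i * x * c j := by
      rw [← Finset.mul_sum, ← mul_add, sub_add_cancel, mul_one]
    rw [hx]
    exact A.add_mem (hmulR hixI hsum) (A.sum_mem fun j _ => h j)
  have hyI : c i * x * c j ∈ I ^ (m + 1) := Ideal.mul_mem_right _ _ hixI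
  have hyI' : c i * x * c j ∈ I := by
    rw [Ideal.IsTwoSided.pow_succ] at hyI
    exact Ideal.mul_le_left hyI
  refine ⟨_, Subalgebra.exists_sub_smul_mem_of_maximal hmax hj ?_ ?_ (hmulL hyI' hyI)⟩
  · intro a _
    refine ⟨f a i, ?_⟩
    have hd : a * c i - f a i • c i ∈ I := by
      rw [hI, RingHom.mem_ker]
      ext l
      by_cases h : l = i
      · subst h
        simp [hc]
      · simp [hc, h]
    have := hmulL hd (Ideal.mul_mem_right (c j) _ hxI)
    simpa only [sub_mul, smul_mul_assoc, mul_assoc] using this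
  · intro a _
    refine ⟨f a j, ?_⟩
    have hd : c j * a - f a j • c j ∈ I := by
      rw [hI, RingHom.mem_ker]
      ext l
      by_cases h : l = j
      · subst h
        simp [hc]
      · simp [hc, h]
    have := hmulR hixI hd
    simpa only [mul_sub, mul_smul_comm, mul_assoc] using this

/-- **Statement 2.** If `k` is algebraically closed and `B` is a finite-dimensional basic
`k`-algebra, then every maximal (unital, proper) subalgebra `A ⊆ B` has dimension
`dim_k A = dim_k B - 1`. -/
theorem maximal_subalgebra_of_basic_has_codim_one
    (k : Type) [Field k] [IsAlgClosed k]
    (B : Type) [Ring B] [Algebra k B] [FiniteDimensional k B]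
    (hB : IsBasicAlgebra k B) (A : Subalgebra k B)
    (hproper : A ≠ ⊤) (hmax : ∀ C : Subalgebra k B, A < C → C = ⊤) :
    Module.finrank k A = Module.finrank k B - 1 := by
  obtain ⟨n, f, hf, hker⟩ := hB
  have : IsArtinianRing B := IsArtinianRing.of_finite k B
  obtain ⟨N, hN⟩ : IsNilpotent (RingHom.ker f) :=
    (show RingHom.ker f = _ from hker) ▸ IsArtinianRing.isNilpotent_jacobson_bot
  suffices h : ∃ x : B, ∀ b, ∃ t : k, b - t • x ∈ A from
    h.elim (Subalgebra.finrank_eq_sub_one_of_exists_sub_smul_mem hproper)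
  classical
  have hex : ∃ l, ∀ b ∈ RingHom.ker f ^ l, b ∈ A := by
    refine ⟨N, fun b hb => ?_⟩
    rw [hN] at hb
    rw [show b = 0 from hb]
    exact A.zero_mem
  have hspec := Nat.find_spec hex
  rcases hl : Nat.find hex with _ | _ | m
  · rw [hl, Submodule.pow_zero, Ideal.one_eq_top] at hspec
    exact absurd (eq_top_iff.mpr fun b _ => hspec b trivial) hproper
  · rw [hl, zero_add, Submodule.pow_one] at hspec
    exact Subalgebra.exists_line_of_maximal_of_ker_le hf hproper hmax hspec
  · rw [hl] at hspec
    exact Subalgebra.exists_line_of_maximal_of_pow_ker_le hf hmax hspec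
      (Nat.find_min hex (by omega))
end

section
/- Let k be an algebraically closed field, B a finite-dimensional basic k-algebra, and A ⊆ B a maximal subalgebra. Then J(A) = A ∩ J(B), J(B)² ⊆ J(A), and J(A) is a two-sided ideal of B (i.e. a B-subbimodule of J(B)): B·J(A) ⊆ J(A) and J(A)·B ⊆ J(A). -/
/-- Every element of the Jacobson radical of an Artinian ring is nilpotent. -/
theorem isNilpotent_of_mem_jacobson_bot {R : Type*} [Ring R] [IsArtinianRing R] {x : R}
    (hx : x ∈ Ideal.jacobson (⊥ : Ideal R)) : IsNilpotent x := by
  obtain ⟨n, hn⟩ := IsArtinianRing.isNilpotent_jacobson_bot (R := R)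
  refine ⟨n, ?_⟩
  have h := Ideal.pow_mem_pow hx n
  rwa [hn, Ideal.zero_eq_bot, Ideal.mem_bot] at h

/-- If every left multiple of `x` is nilpotent, then `x` lies in the Jacobson radical. -/
theorem mem_jacobson_bot_of_forall_isNilpotent_mul {R : Type*} [Ring R] {x : R}
    (h : ∀ y : R, IsNilpotent (y * x)) : x ∈ Ideal.jacobson (⊥ : Ideal R) := by
  refine Ideal.mem_jacobson_iff.2 fun y => ?_
  obtain ⟨z, hz⟩ := (h y).isUnit_add_one.exists_left_inv
  refine ⟨z, ?_⟩
  rw [Ideal.mem_bot, mul_assoc, ← mul_add_one, hz, sub_self]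

/-- A subalgebra of a basic algebra has as Jacobson radical the trace of the radical of the
ambient algebra. -/
theorem IsBasicAlgebra.mem_jacobson_subalgebra_iff {k B : Type} [Field k] [Ring B] [Algebra k B]
    [FiniteDimensional k B] (hB : IsBasicAlgebra k B) (A : Subalgebra k B) (x : A) :
    x ∈ Ideal.jacobson (⊥ : Ideal A) ↔ (x : B) ∈ Ideal.jacobson (⊥ : Ideal B) := by
  have : IsArtinianRing A := IsArtinianRing.of_finite k A
  have : IsArtinianRing B := IsArtinianRing.of_finite k B
  constructor
  · intro hx
    obtain ⟨n, f, -, hf⟩ := hB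
    rw [← hf, RingHom.mem_ker]
    exact ((isNilpotent_of_mem_jacobson_bot hx).map (f.comp A.val)).eq_zero
  · intro hx
    refine mem_jacobson_bot_of_forall_isNilpotent_mul fun y => ?_
    exact (IsNilpotent.map_iff (f := A.val) Subtype.val_injective).1
      (isNilpotent_of_mem_jacobson_bot (Ideal.mul_mem_left _ (y : B) hx))

/-- A maximal subalgebra either contains a given two-sided ideal or spans the algebra
together with it. -/
theorem Subalgebra.ideal_le_or_exists_add_of_maximal {k B : Type*} [CommRing k] [Ring B]
    [Algebra k B] {A : Subalgebra k B} (hmax : ∀ C : Subalgebra k B, A < C → C = ⊤)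
    (I : Ideal B) [I.IsTwoSided] :
    (∀ x ∈ I, x ∈ A) ∨ ∀ b : B, ∃ a ∈ A, ∃ u ∈ I, b = a + u := by
  let C := (A.map (Ideal.Quotient.mkₐ k I)).comap (Ideal.Quotient.mkₐ k I)
  have hAC : A ≤ C := fun a ha => ⟨a, ha, rfl⟩
  rcases hAC.eq_or_lt with h | h
  · left
    intro x hx
    rw [h]
    exact ⟨0, A.zero_mem, by
      simpa using (Ideal.Quotient.eq_zero_iff_mem.2 hx).symm⟩
  · right
    intro b
    have hb : b ∈ C := by rw [hmax C h]; trivial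
    obtain ⟨a, ha, hab⟩ := hb
    exact ⟨a, ha, b - a, (Ideal.Quotient.mk_eq_mk_iff_sub_mem b a).1 hab.symm, by abel⟩

/-- A maximal subalgebra containing a power of a two-sided ideal contains its square. -/
theorem Subalgebra.mul_mem_of_pow_le_of_maximal {k B : Type*} [CommRing k] [Ring B]
    [Algebra k B] {A : Subalgebra k B} (hmax : ∀ C : Subalgebra k B, A < C → C = ⊤)
    (I : Ideal B) [I.IsTwoSided] {m : ℕ} (hm : ∀ x ∈ I ^ m, x ∈ A) {x y : B} (hx : x ∈ I)
    (hy : y ∈ I) : x * y ∈ A := by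
  induction m with
  | zero => exact hm _ (by rw [Submodule.pow_zero, Ideal.one_eq_top]; trivial)
  | succ m ih =>
    obtain hm2 | hm2 := Nat.lt_or_ge m 2
    · refine hm _ (Ideal.pow_le_pow_right (show m + 1 ≤ 2 by omega) ?_)
      rw [Submodule.pow_succ, Submodule.pow_one]
      exact Ideal.mul_mem_mul hx hy
    · obtain h | h := Subalgebra.ideal_le_or_exists_add_of_maximal hmax (I ^ m)
      · exact ih h
      · obtain ⟨a, ha, u, hu, rfl⟩ := h x
        obtain ⟨c, hc, v, hv, rfl⟩ := h y
        have hle : I ^ m ≤ I := Ideal.pow_le_self (by omega)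
        have haI : a ∈ I := (I.add_mem_iff_left (hle hu)).1 hx
        have h1 : u * (c + v) ∈ A := hm _ (by
          rw [Submodule.pow_succ]; exact Ideal.mul_mem_mul hu hy)
        have h2 : a * v ∈ A := hm _ (by
          rw [Ideal.IsTwoSided.pow_succ]; exact Ideal.mul_mem_mul haI hv)
        have h3 : (a + u) * (c + v) = a * c + a * v + u * (c + v) := by noncomm_ring
        rw [h3]
        exact A.add_mem (A.add_mem (A.mul_mem ha hc) h2) h1

/-- **Statement 3.** Let `k` be algebraically closed, `B` a finite-dimensional basic
`k`-algebra and `A ⊆ B` a maximal subalgebra. Then: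
* `J(A) = A ∩ J(B)` (an element of `A` is in `J(A)` iff it is in `J(B)` as an element of `B`);
* `J(B)² ⊆ J(A)` (the square being the span of products, i.e. the ideal product);
* `J(A)` is a `B`-subbimodule of `J(B)`: `B·J(A) ⊆ J(A)` and `J(A)·B ⊆ J(A)`. -/
theorem jacobson_radical_of_maximal_subalgebra
    (k : Type) [Field k] [IsAlgClosed k]
    (B : Type) [Ring B] [Algebra k B] [FiniteDimensional k B]
    (hB : IsBasicAlgebra k B) (A : Subalgebra k B)
    (hproper : A ≠ ⊤) (hmax : ∀ C : Subalgebra k B, A < C → C = ⊤) :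
    (∀ x : A, x ∈ Ideal.jacobson (⊥ : Ideal A) ↔ (x : B) ∈ Ideal.jacobson (⊥ : Ideal B)) ∧
    (∀ x : B, x ∈ (Submodule.restrictScalars k (Ideal.jacobson (⊥ : Ideal B))) ^ 2 →
      ∃ hx : x ∈ A, (⟨x, hx⟩ : A) ∈ Ideal.jacobson (⊥ : Ideal A)) ∧
    (∀ (b x : B), (∃ a : A, a ∈ Ideal.jacobson (⊥ : Ideal A) ∧ (a : B) = x) →
      (∃ a : A, a ∈ Ideal.jacobson (⊥ : Ideal A) ∧ (a : B) = b * x) ∧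
      (∃ a : A, a ∈ Ideal.jacobson (⊥ : Ideal A) ∧ (a : B) = x * b)) := by
  have : IsArtinianRing B := IsArtinianRing.of_finite k B
  have hrad := hB.mem_jacobson_subalgebra_iff A
  obtain ⟨n, hn⟩ := IsArtinianRing.isNilpotent_jacobson_bot (R := B)
  have hsq : ∀ x ∈ Ideal.jacobson (⊥ : Ideal B), ∀ y ∈ Ideal.jacobson (⊥ : Ideal B),
      x * y ∈ A := fun x hx y hy =>
    Subalgebra.mul_mem_of_pow_le_of_maximal hmax _ (m := n) (fun z hz => by
      rw [hn, Ideal.zero_eq_bot, Ideal.mem_bot] at hz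
      exact hz ▸ A.zero_mem) hx hy
  refine ⟨hrad, fun x hx => ?_, ?_⟩
  · have hle : (Submodule.restrictScalars k (Ideal.jacobson (⊥ : Ideal B))) ^ 2 ≤
        Subalgebra.toSubmodule A ⊓ Submodule.restrictScalars k (Ideal.jacobson (⊥ : Ideal B)) := by
      rw [pow_two, Submodule.mul_le]
      exact fun x hx y hy => ⟨hsq x hx y hy, Ideal.mul_mem_left _ x hy⟩
    exact ⟨(hle hx).1, (hrad _).2 (hle hx).2⟩
  · rintro b x ⟨x, hx, rfl⟩
    have hxJ := (hrad x).1 hx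
    suffices h : b * x ∈ A ∧ x * b ∈ A from
      ⟨⟨⟨_, h.1⟩, (hrad _).2 (Ideal.mul_mem_left _ b hxJ), rfl⟩,
        ⟨⟨_, h.2⟩, (hrad _).2 (Ideal.mul_mem_right b _ hxJ), rfl⟩⟩
    obtain h | h := Subalgebra.ideal_le_or_exists_add_of_maximal hmax
      (Ideal.jacobson (⊥ : Ideal B))
    · exact ⟨h _ (Ideal.mul_mem_left _ b hxJ), h _ (Ideal.mul_mem_right b _ hxJ)⟩
    · obtain ⟨a, ha, u, hu, rfl⟩ := h b
      rw [add_mul, mul_add]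
      exact ⟨A.add_mem (A.mul_mem ha x.2) (hsq _ hu _ hxJ),
        A.add_mem (A.mul_mem x.2 ha) (hsq _ hxJ _ hu)⟩
end

section
/- Let k be an algebraically closed field, B a finite-dimensional basic k-algebra with n = dim_k B, and A ⊆ B a unital subalgebra with m = dim_k A. Then J(B)^{2(n−m)} ⊆ A. -/
open Module

/-- A bilinear form vanishing on `W × W` has rank at most twice the codimension of `W`. -/
theorem LinearMap.finrank_range_le_of_isotropic {k V : Type*} [Field k] [AddCommGroup V]
    [Module k V] [FiniteDimensional k V] (β : V →ₗ[k] Dual k V) (W : Submodule k V)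
    (hW : ∀ x ∈ W, ∀ y ∈ W, β x y = 0) :
    finrank k (LinearMap.range β) ≤ 2 * (finrank k V - finrank k W) := by
  obtain ⟨C, hC⟩ := W.exists_isCompl
  have hcodim := Submodule.finrank_add_eq_of_isCompl hC
  have hann := Subspace.finrank_add_finrank_dualAnnihilator_eq W
  have hmapW : finrank k (W.map β) ≤ finrank k W.dualAnnihilator := by
    refine Submodule.finrank_mono ?_
    rintro _ ⟨x, hx, rfl⟩
    exact (Submodule.mem_dualAnnihilator _).2 fun y hy => hW x hx y hy
  have hmapC := Submodule.finrank_map_le β C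
  have hrange : LinearMap.range β = W.map β ⊔ C.map β := by
    rw [← Submodule.map_sup, hC.sup_eq_top, LinearMap.range_eq_map]
  have hsup := Submodule.finrank_add_le_finrank_add_finrank (W.map β) (C.map β)
  rw [hrange]
  omega

/-- A bilinear form with a nonsingular upper triangular `n × n` Gram matrix has rank at
least `n`. -/
theorem LinearMap.le_finrank_range_of_triangular {k V : Type*} [Field k] [AddCommGroup V]
    [Module k V] [FiniteDimensional k V] (β : V →ₗ[k] Dual k V) {n : ℕ} (p q : Fin n → V)
    (hdiag : ∀ i, β (p i) (q i) ≠ 0) (htri : ∀ i j, j < i → β (p i) (q j) = 0) :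
    n ≤ finrank k (LinearMap.range β) := by
  let M : Matrix (Fin n) (Fin n) k := Matrix.of fun i j => β (p i) (q j)
  have hdet : M.det ≠ 0 := by
    rw [Matrix.det_of_isUpperTriangular (M := M) (fun i j hij => htri i j hij)]
    exact Finset.prod_ne_zero_iff.2 fun i _ => hdiag i
  have hM := Matrix.linearIndependent_rows_of_det_ne_zero hdet
  let ev : Dual k V →ₗ[k] (Fin n → k) := LinearMap.pi fun j => Dual.eval k V (q j)
  have hli : LinearIndependent k fun i => β.rangeRestrict (p i) :=
    LinearIndependent.of_comp (ev ∘ₗ (LinearMap.range β).subtype) hM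
  simpa using hli.fintype_card_le_finrank

theorem Submodule.list_prod_mem_pow_length {k B : Type*} [Field k] [Ring B] [Algebra k B]
    (N : Submodule k B) (l : List B) (hl : ∀ x ∈ l, x ∈ N) : l.prod ∈ N ^ l.length := by
  induction l with
  | nil => simpa using Submodule.one_le.1 (le_refl (1 : Submodule k B))
  | cons a l ih =>
    rw [List.prod_cons, List.length_cons, pow_succ']
    exact Submodule.mul_mem_mul (hl a (by simp)) (ih fun x hx => hl x (by simp [hx]))

/-- A linear form that is nonzero on `N ^ t` is nonzero on some product of `t` elements of `N`. -/
theorem Submodule.exists_list_prod_ne_zero {k B : Type*} [Field k] [Ring B] [Algebra k B]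
    (N : Submodule k B) (φ : Dual k B) {t : ℕ} {x : B} (hx : x ∈ N ^ t) (hφ : φ x ≠ 0) :
    ∃ l : List B, l.length = t ∧ (∀ y ∈ l, y ∈ N) ∧ φ l.prod ≠ 0 := by
  by_contra! h
  have hle : N ^ t ≤ LinearMap.ker φ := by
    rw [Submodule.pow_eq_span_pow_set, Submodule.span_le]
    intro y hy
    obtain ⟨f, rfl⟩ := Set.mem_pow.1 hy
    exact h _ (by simp) (by simp [List.mem_ofFn])
  exact hφ (hle hx)

/-- If `N` is a nilpotent subspace of `B`, then `N ^ (2 c)` is contained in every subalgebra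
of codimension `c`. -/
theorem Subalgebra.nilpotent_pow_le {k B : Type*} [Field k] [Ring B] [Algebra k B]
    [FiniteDimensional k B] (A : Subalgebra k B) (N : Submodule k B) (hN : IsNilpotent N) :
    N ^ (2 * (finrank k B - finrank k A)) ≤ Subalgebra.toSubmodule A := by
  classical
  intro x hx
  by_contra hxA
  obtain ⟨φ, hφx, hφA⟩ := Submodule.exists_le_ker_of_notMem hxA
  obtain ⟨L, hL⟩ := hN
  have hzero : ∀ s, L ≤ s → N ^ s = 0 := fun s hs => pow_eq_zero_of_le hs hL
  let P : ℕ → Prop := fun s => ∃ y ∈ N ^ s, φ y ≠ 0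
  have hPL : ∀ s, P s → s ≤ L := by
    rintro s ⟨y, hy, hφy⟩
    by_contra! hs
    rw [hzero s hs.le, Submodule.zero_eq_bot, Submodule.mem_bot] at hy
    exact hφy (by rw [hy, map_zero])
  have hP : P (2 * (finrank k B - finrank k A)) := ⟨x, hx, hφx⟩
  set t := Nat.findGreatest P L
  have hle_t : ∀ s, P s → s ≤ t := fun s hs => Nat.le_findGreatest (hPL s hs) hs
  obtain ⟨y, hy, hφy⟩ : P t := Nat.findGreatest_spec (hPL _ hP) hP
  obtain ⟨l, hlen, hlN, hφl⟩ := N.exists_list_prod_ne_zero φ hy hφy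
  let β : B →ₗ[k] Dual k B := (LinearMap.mul k B).compr₂ φ
  have hlower := LinearMap.le_finrank_range_of_triangular β (n := t + 1)
    (fun i => (l.take i).prod) (fun j => (l.drop j).prod)
    (fun i => by simpa [β, List.prod_take_mul_prod_drop] using hφl)
    (fun i j hij => by
      by_contra hne
      have hp := N.list_prod_mem_pow_length (l.take i) fun x hx => hlN x (List.mem_of_mem_take hx)
      have hq := N.list_prod_mem_pow_length (l.drop j) fun x hx => hlN x (List.mem_of_mem_drop hx)
      have hmem := Submodule.mul_mem_mul hp hq
      rw [← pow_add] at hmem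
      have hbound := hle_t _ ⟨_, hmem, hne⟩
      rw [List.length_take, List.length_drop, hlen] at hbound
      omega)
  have hupper := LinearMap.finrank_range_le_of_isotropic β (Subalgebra.toSubmodule A)
    fun a ha b hb => hφA (A.mul_mem ha hb)
  have hfin : finrank k (Subalgebra.toSubmodule A) = finrank k A := rfl
  have := hle_t _ hP
  omega

theorem Ideal.restrictScalars_pow_le (k : Type*) {B : Type*} [Field k] [Ring B] [Algebra k B]
    (I : Ideal B) {n : ℕ} (hn : n ≠ 0) :
    (Submodule.restrictScalars k I) ^ n ≤ Submodule.restrictScalars k (I ^ n) := by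
  induction n, Nat.one_le_iff_ne_zero.2 hn using Nat.le_induction with
  | base => simp [Submodule.pow_one]
  | succ n hn' ih =>
    rw [pow_succ, Submodule.mul_le]
    intro a ha b hb
    rw [Submodule.restrictScalars_mem, Submodule.pow_succ (n := n)]
    exact Ideal.mul_mem_mul (ih (by omega) ha) hb

theorem isNilpotent_restrictScalars_jacobson_bot (k B : Type*) [Field k] [Ring B] [Algebra k B]
    [FiniteDimensional k B] :
    IsNilpotent (Submodule.restrictScalars k (Ideal.jacobson (⊥ : Ideal B))) := by
  have : IsArtinianRing B := IsArtinianRing.of_finite k B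
  obtain ⟨n, hn⟩ := IsArtinianRing.isNilpotent_jacobson_bot (R := B)
  refine ⟨n + 1, (Submodule.eq_bot_iff _).2 fun x hx => ?_⟩
  have hmem := Ideal.restrictScalars_pow_le k _ n.succ_ne_zero hx
  rw [Submodule.restrictScalars_mem, Submodule.pow_succ, hn, zero_mul] at hmem
  simpa using hmem

/-- **Statement 4.** Let `k` be algebraically closed, `B` a finite-dimensional basic
`k`-algebra with `n = dim_k B`, and `A ⊆ B` a unital subalgebra with `m = dim_k A`.
Then `J(B)^{2(n-m)} ⊆ A`, where powers of `J(B)` are spans of products. -/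
theorem jacobson_power_le_subalgebra
    (k : Type) [Field k] [IsAlgClosed k]
    (B : Type) [Ring B] [Algebra k B] [FiniteDimensional k B]
    (hB : IsBasicAlgebra k B) (A : Subalgebra k B) :
    ∀ x : B,
      x ∈ (Submodule.restrictScalars k (Ideal.jacobson (⊥ : Ideal B))) ^
            (2 * (Module.finrank k B - Module.finrank k A)) →
      x ∈ A := by
  exact fun x hx => A.nilpotent_pow_le _ (isNilpotent_restrictScalars_jacobson_bot k B) hx
end

section
/- Let k be an algebraically closed field, B a finite-dimensional basic k-algebra with n = dim_k B, and 1 ≤ m ≤ n. Let N = J(B)^{2(n−m)} and let π : B → B/N be the quotient map. Then A ↦ π(A) is a bijection from the set of m-dimensional unital subalgebras of B onto the set of (m − dim_k N)-dimensional unital subalgebras of B/N, with inverse given by Ā ↦ π^{-1}(Ā). -/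
/-- If an antitone sequence drops at `i + 1` or at `f - (i + 1)` for every `i + 1 < f`, and also drops
at `f`, then its total drop over `[1, f]` is at least `(f + 1) / 2`. -/
theorem succ_le_two_mul_drop {g : ℕ → ℕ} {f : ℕ}
    (hg : ∀ i, g (i + 2) ≤ g (i + 1))
    (hpair : ∀ i j, i + j + 2 = f + 1 → g (i + 2) < g (i + 1) ∨ g (j + 2) < g (j + 1))
    (hf : g (f + 2) < g (f + 1)) :
    f + 2 + 2 * g (f + 2) ≤ 2 * g 1 := by
  have hsum : ∑ i ∈ Finset.range f, ((g (i + 1) : ℤ) - g (i + 2)) = g 1 - g (f + 1) :=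
    Finset.sum_range_sub' (fun i => (g (i + 1) : ℤ)) f
  have hrefl := Finset.sum_range_reflect (fun i => (g (i + 1) : ℤ) - g (i + 2)) f
  have hle : ∑ _i ∈ Finset.range f, (1 : ℤ) ≤ ∑ i ∈ Finset.range f,
      (((g (i + 1) : ℤ) - g (i + 2)) + ((g (f - 1 - i + 1) : ℤ) - g (f - 1 - i + 2))) := by
    refine Finset.sum_le_sum fun i hi => ?_
    have hi' := Finset.mem_range.mp hi
    have h₁ := hg i
    have h₂ := hg (f - 1 - i)
    have h₃ := hpair i (f - 1 - i) (by omega)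
    omega
  rw [Finset.sum_add_distrib, hrefl, hsum] at hle
  simp only [Finset.sum_const, Finset.card_range, nsmul_eq_mul, mul_one] at hle
  omega

section

variable {k B : Type*} [Field k] [Ring B] [Algebra k B]

theorem Submodule.pow_succ_le_pow {J : Submodule k B} (hJ : J * J ≤ J) {i : ℕ} (hi : 1 ≤ i) :
    J ^ (i + 1) ≤ J ^ i := by
  obtain ⟨i, rfl⟩ := Nat.exists_eq_add_of_le' hi
  calc J ^ (i + 1 + 1) = J ^ i * (J * J) := by rw [_root_.pow_succ, _root_.pow_succ, mul_assoc]
    _ ≤ J ^ i * J := mul_le_mul_right hJ _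
    _ = J ^ (i + 1) := (_root_.pow_succ _ _).symm

theorem Subalgebra.pow_add_le_sup {J : Submodule k B} (hJ : J * J ≤ J) (A : Subalgebra k B)
    {i j : ℕ} (hi : 1 ≤ i)
    (hAi : J ^ i ≤ Subalgebra.toSubmodule A ⊔ J ^ (i + 1))
    (hAj : J ^ j ≤ Subalgebra.toSubmodule A ⊔ J ^ (j + 1)) :
    J ^ (i + j) ≤ Subalgebra.toSubmodule A ⊔ J ^ (i + j + 1) := by
  rw [_root_.pow_add, Submodule.mul_le]
  intro x hx y hy
  obtain ⟨a, ha, x', hx', rfl⟩ := Submodule.mem_sup.mp (hAi hx)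
  obtain ⟨b, hb, y', hy', rfl⟩ := Submodule.mem_sup.mp (hAj hy)
  have ha' : a ∈ J ^ i := by
    simpa using sub_mem hx (Submodule.pow_succ_le_pow hJ hi hx')
  have h₁ : a * y' ∈ J ^ (i + j + 1) := by
    rw [add_assoc, _root_.pow_add]
    exact Submodule.mul_mem_mul ha' hy'
  have h₂ : x' * (b + y') ∈ J ^ (i + j + 1) := by
    rw [add_right_comm, _root_.pow_add]
    exact Submodule.mul_mem_mul hx' hy
  refine Submodule.mem_sup.mpr ⟨a * b, A.mul_mem ha hb, a * y' + x' * (b + y'),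
    add_mem h₁ h₂, ?_⟩
  rw [add_mul, mul_add a, add_assoc]

/-- A subalgebra of codimension at most `c ≥ 1` contains `J ^ (2 * c)` for every nilpotent,
multiplicatively closed subspace `J`. -/
theorem Subalgebra.pow_two_mul_codim_le [FiniteDimensional k B] {J : Submodule k B}
    (hJ : J * J ≤ J) (hnil : IsNilpotent J) (A : Subalgebra k B) {c : ℕ} (hc : 1 ≤ c)
    (hA : Module.finrank k B ≤ Module.finrank k A + c) :
    J ^ (2 * c) ≤ Subalgebra.toSubmodule A := by
  set S := Subalgebra.toSubmodule A with hS
  have hstep : ∀ f, 2 * c ≤ f + 1 → J ^ (f + 1) ≤ S ⊔ J ^ (f + 2) := by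
    intro f hf
    by_contra hgap
    have hanti : ∀ i, S ⊔ J ^ (i + 2) ≤ S ⊔ J ^ (i + 1) := fun i =>
      sup_le_sup_left (Submodule.pow_succ_le_pow hJ (Nat.le_add_left 1 i)) S
    have hdrop : ∀ i, ¬ J ^ (i + 1) ≤ S ⊔ J ^ (i + 2) →
        Module.finrank k ↥(S ⊔ J ^ (i + 2)) < Module.finrank k ↥(S ⊔ J ^ (i + 1)) := fun i hi =>
      Submodule.finrank_lt_finrank_of_lt
        (lt_of_le_not_ge (hanti i) fun h => hi (le_sup_right.trans h))
    have hcount := succ_le_two_mul_drop (g := fun i => Module.finrank k ↥(S ⊔ J ^ i)) (f := f)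
      (fun i => Submodule.finrank_mono (hanti i))
      (fun i j hij => by
        by_contra! hcon
        have hi : J ^ (i + 1) ≤ S ⊔ J ^ (i + 2) :=
          not_not.mp fun h => (hdrop i h).not_ge hcon.1
        have hj : J ^ (j + 1) ≤ S ⊔ J ^ (j + 2) :=
          not_not.mp fun h => (hdrop j h).not_ge hcon.2
        have h := A.pow_add_le_sup hJ (Nat.le_add_left 1 i) hi hj
        rw [show i + 1 + (j + 1) = f + 1 by omega] at h
        exact hgap h)
      (hdrop f hgap)
    have h₁ : Module.finrank k A ≤ Module.finrank k ↥(S ⊔ J ^ (f + 2)) :=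
      Submodule.finrank_mono (s := S) le_sup_left
    have h₂ : Module.finrank k ↥(S ⊔ J ^ 1) ≤ Module.finrank k B := Submodule.finrank_le _
    omega
  have hiter : ∀ r, J ^ (2 * c) ≤ S ⊔ J ^ (2 * c + r) := by
    intro r
    induction r with
    | zero => exact le_sup_right
    | succ r ih =>
      refine ih.trans (sup_le le_sup_left ?_)
      have h := hstep (2 * c + r - 1) (by omega)
      rwa [show 2 * c + r - 1 + 1 = 2 * c + r by omega,
        show 2 * c + r - 1 + 2 = 2 * c + (r + 1) by omega] at h
  obtain ⟨r, hr⟩ := hnil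
  have h := hiter r
  rwa [_root_.pow_add, hr, mul_zero, Submodule.zero_eq_bot, sup_bot_eq] at h

end

theorem Ideal.isNilpotent_restrictScalars {k B : Type*} [Field k] [Ring B] [Algebra k B]
    {I : Ideal B} (hI : IsNilpotent I) : IsNilpotent (Submodule.restrictScalars k I) := by
  obtain ⟨r, hr⟩ := hI
  refine ⟨r + 1, ?_⟩
  have hr' : I ^ (r + 1) = 0 := by
    rw [Submodule.pow_succ, hr]
    exact Submodule.bot_mul I
  exact (Submodule.restrictScalars_pow r.succ_ne_zero).symm.trans
    (congrArg (Submodule.restrictScalars k) hr')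

theorem Subalgebra.finrank_comap_of_surjective {k B C : Type*} [Field k] [Ring B] [Algebra k B]
    [FiniteDimensional k B] [Ring C] [Algebra k C] {π : B →ₐ[k] C} (hπ : Function.Surjective π)
    (A' : Subalgebra k C) :
    Module.finrank k (A'.comap π) =
      Module.finrank k A' + Module.finrank k (LinearMap.ker π.toLinearMap) := by
  set P := Subalgebra.toSubmodule (A'.comap π)
  have hP : LinearMap.ker π.toLinearMap ≤ P := fun x hx => by
    change π x ∈ A'
    rw [show π x = 0 from hx]
    exact A'.zero_mem
  have hrange : LinearMap.range (π.toLinearMap.domRestrict P) = Subalgebra.toSubmodule A' := by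
    rw [LinearMap.range_domRestrict]
    exact congrArg Subalgebra.toSubmodule (Subalgebra.map_comap_eq_self_of_surjective hπ A')
  have hker : LinearMap.ker (π.toLinearMap.domRestrict P) =
      (LinearMap.ker π.toLinearMap).comap P.subtype := rfl
  have h := (π.toLinearMap.domRestrict P).finrank_range_add_finrank_ker
  rw [hrange, hker, (Submodule.comapSubtypeEquivOfLe hP).finrank_eq] at h
  exact h.symm

/-- **Statement 10.** Let `B` be a finite-dimensional basic `k`-algebra, `n = dim_k B`,
`1 ≤ m ≤ n`, `N = J(B)^{2(n-m)}` and `π : B → B/N` the quotient map (realized as any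
surjective algebra map with kernel `N`). Then `A ↦ π(A)` is a bijection from the set of
`m`-dimensional unital subalgebras of `B` onto the set of `(m - dim_k N)`-dimensional
unital subalgebras of `B/N`, with inverse `A' ↦ π⁻¹(A')`. -/
theorem subalgebras_biject_with_quotient_subalgebras
    (k : Type) [Field k] [IsAlgClosed k]
    (B : Type) [Ring B] [Algebra k B] [FiniteDimensional k B]
    (hB : IsBasicAlgebra k B)
    (m : ℕ) (hm1 : 1 ≤ m) (hmn : m ≤ Module.finrank k B)
    (C : Type) [Ring C] [Algebra k C]
    (π : B →ₐ[k] C) (hπ : Function.Surjective π)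
    (hker : ∀ x : B, π x = 0 ↔
      x ∈ (Submodule.restrictScalars k (Ideal.jacobson (⊥ : Ideal B))) ^
            (2 * (Module.finrank k B - m))) :
    Set.BijOn (fun A : Subalgebra k B => Subalgebra.map π A)
      {A : Subalgebra k B | Module.finrank k A = m}
      {A' : Subalgebra k C | Module.finrank k A' =
        m - Module.finrank k
          ↥((Submodule.restrictScalars k (Ideal.jacobson (⊥ : Ideal B))) ^
            (2 * (Module.finrank k B - m)))} ∧
    (∀ A : Subalgebra k B, Module.finrank k A = m →
      Subalgebra.comap π (Subalgebra.map π A) = A) ∧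
    (∀ A' : Subalgebra k C,
      Module.finrank k A' =
        m - Module.finrank k
          ↥((Submodule.restrictScalars k (Ideal.jacobson (⊥ : Ideal B))) ^
            (2 * (Module.finrank k B - m))) →
      Module.finrank k (Subalgebra.comap π A') = m ∧
      Subalgebra.map π (Subalgebra.comap π A') = A') := by
  set J := Submodule.restrictScalars k (Ideal.jacobson (⊥ : Ideal B)) with hJdef
  set N := J ^ (2 * (Module.finrank k B - m)) with hN
  have hJ : J * J ≤ J := Submodule.mul_le.mpr fun x _ y hy =>
    (Ideal.jacobson (⊥ : Ideal B)).mul_mem_left x hy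
  have : IsArtinianRing B := IsArtinianRing.of_finite k B
  have hnil : IsNilpotent J :=
    Ideal.isNilpotent_restrictScalars IsArtinianRing.isNilpotent_jacobson_bot
  have hkerN : LinearMap.ker π.toLinearMap = N := Submodule.ext hker
  have hfin (A' : Subalgebra k C) := A'.finrank_comap_of_surjective hπ
  rw [hkerN] at hfin
  have hNA (A : Subalgebra k B) (hA : Module.finrank k A = m) :
      N ≤ Subalgebra.toSubmodule A := by
    rcases hmn.eq_or_lt with h | h
    · have : Subalgebra.toSubmodule A = ⊤ := Submodule.eq_top_of_finrank_eq (hA.trans h)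
      exact this ▸ le_top
    · exact A.pow_two_mul_codim_le hJ hnil (by omega) (by omega)
  have hcm (A : Subalgebra k B) (hA : Module.finrank k A = m) : (A.map π).comap π = A :=
    Subalgebra.comap_map_eq_self fun x hx => hNA A hA ((hker x).mp hx)
  have hmc (A' : Subalgebra k C) : (A'.comap π).map π = A' :=
    Subalgebra.map_comap_eq_self_of_surjective hπ A'
  have hNm (A' : Subalgebra k C) (hA' : Module.finrank k A' = m - Module.finrank k N) :
      Module.finrank k (A'.comap π) = m := by
    have h := hfin A'
    suffices Module.finrank k N ≤ m by omega
    by_contra! hlt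
    have : Module.Finite k C := Module.Finite.of_surjective π.toLinearMap hπ
    have : Subsingleton A' := (Module.finrank_zero_iff (R := k)).mp (by omega)
    have hone : (1 : B) ∈ N := (hker 1).mp <| by
      rw [map_one]
      exact congrArg Subtype.val (Subsingleton.elim (1 : A') 0)
    have hmlt : m < Module.finrank k B := hlt.trans_le (Submodule.finrank_le N)
    have hNJ : N ≤ J := by
      rw [hN, show 2 * (Module.finrank k B - m) = 2 * (Module.finrank k B - m) - 1 + 1 by omega,
        _root_.pow_succ]
      exact Submodule.mul_le.mpr fun x _ y hy =>
        (Ideal.jacobson (⊥ : Ideal B)).mul_mem_left x hy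
    have hbot : (⊥ : Ideal B) = ⊤ :=
      Ideal.jacobson_eq_top_iff.mp ((Ideal.eq_top_iff_one _).mpr (hNJ hone))
    have : Subsingleton B := (Submodule.subsingleton_iff B).mp (subsingleton_of_bot_eq_top hbot)
    have hzero : Module.finrank k B = 0 := Module.finrank_zero_of_subsingleton
    omega
  refine ⟨⟨fun A hA => ?_, fun A hA A₂ hA₂ h => ?_, fun A' hA' => ⟨A'.comap π, hNm A' hA', hmc A'⟩⟩,
    hcm, fun A' hA' => ⟨hNm A' hA', hmc A'⟩⟩
  · have h := hfin (A.map π)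
    rw [hcm A hA, hA] at h
    exact Nat.eq_sub_of_add_eq h.symm
  · rw [← hcm A hA, ← hcm A₂ hA₂]
    exact congrArg (Subalgebra.comap π) h
end
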